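/- arXiv:2210.02602 — 5 statements merged into one kernel-verified Lean document; each statement's English description precedes it below -/
import Mathlib

section
/- For every x ∈ ℝⁿ with Ax ≠ 0, one has the strict inequality ‖Qx‖₂ < ‖x‖₂. -/
open Matrix

noncomputable section

/-- The Euclidean norm on `Fin k → ℝ`. -/
def euclNorm {k : ℕ} (x : Fin k → ℝ) : ℝ := Real.sqrt (∑ i, x i ^ 2)

/-- The orthogonal projection `Pᵢ = I − aᵢaᵢᵀ/‖aᵢ‖₂²` onto the hyperplane `{x : aᵢᵀx = 0}`,
where `aᵢ` is the `i`-th row of `A`. -/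
def projMat {m n : ℕ} (A : Matrix (Fin m) (Fin n) ℝ) (i : Fin m) :
    Matrix (Fin n) (Fin n) ℝ :=
  1 - (euclNorm (A i) ^ 2)⁻¹ • Matrix.vecMulVec (A i) (A i)

/-- `Q = P_m P_{m−1} ⋯ P₁` (rows 0-indexed, so `Q = P_{m−1} ⋯ P₀`). -/
def Qmat {m n : ℕ} (A : Matrix (Fin m) (Fin n) ℝ) : Matrix (Fin n) (Fin n) ℝ :=
  ((List.finRange m).reverse.map (projMat A)).prod

/-- `Q_j = P_m P_{m−1} ⋯ P_{j+1}` (rows 0-indexed, so row `j` gets `P_{m−1} ⋯ P_{j+1}`);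
in particular the last one is the identity. -/
def Qpart {m n : ℕ} (A : Matrix (Fin m) (Fin n) ℝ) (j : Fin m) : Matrix (Fin n) (Fin n) ℝ :=
  (((List.finRange m).drop ((j : ℕ) + 1)).reverse.map (projMat A)).prod

/-- `A_S`: the `j`-th row is `Q_j a_j`. -/
def AS {m n : ℕ} (A : Matrix (Fin m) (Fin n) ℝ) : Matrix (Fin m) (Fin n) ℝ :=
  Matrix.of fun j => (Qpart A j).mulVec (A j)

/-- `M = diag(1/‖a₁‖₂², …, 1/‖a_m‖₂²)`. -/
def Mdiag {m n : ℕ} (A : Matrix (Fin m) (Fin n) ℝ) : Matrix (Fin m) (Fin m) ℝ :=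
  Matrix.diagonal fun i => (euclNorm (A i) ^ 2)⁻¹

/-- The spectral norm of a matrix: the operator norm of the induced linear map
between Euclidean spaces. -/
def spec {k l : ℕ} (B : Matrix (Fin k) (Fin l) ℝ) : ℝ :=
  ‖LinearMap.toContinuousLinearMap (Matrix.toEuclideanLin B)‖

/-- `σ` is a singular value of the square matrix `B`: `σ ≥ 0` and `σ²` is an
eigenvalue of `BᵀB`. -/
def IsSingularValue {k : ℕ} (B : Matrix (Fin k) (Fin k) ℝ) (σ : ℝ) : Prop :=
  0 ≤ σ ∧ ∃ x : Fin k → ℝ, x ≠ 0 ∧ (Bᵀ * B).mulVec x = (σ ^ 2) • x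

lemma euclNorm_eq_sqrt_dotProduct {k : ℕ} (x : Fin k → ℝ) : euclNorm x = Real.sqrt (x ⬝ᵥ x) := by
  simp only [euclNorm, dotProduct, sq]

lemma euclNorm_sq {k : ℕ} (x : Fin k → ℝ) : euclNorm x ^ 2 = x ⬝ᵥ x := by
  rw [euclNorm_eq_sqrt_dotProduct, Real.sq_sqrt]
  exact Finset.sum_nonneg fun i _ => mul_self_nonneg (x i)

lemma projMat_mulVec {m n : ℕ} (A : Matrix (Fin m) (Fin n) ℝ) (i : Fin m) (x : Fin n → ℝ) :
    projMat A i *ᵥ x = x - ((A i ⬝ᵥ A i)⁻¹ * (A i ⬝ᵥ x)) • A i := by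
  rw [projMat, euclNorm_sq, sub_mulVec, one_mulVec, smul_mulVec, vecMulVec_mulVec,
    op_smul_eq_smul, smul_smul]

lemma projMat_mulVec_dotProduct_self {m n : ℕ} (A : Matrix (Fin m) (Fin n) ℝ) {i : Fin m}
    (hi : A i ≠ 0) (x : Fin n → ℝ) :
    (projMat A i *ᵥ x) ⬝ᵥ (projMat A i *ᵥ x) =
      x ⬝ᵥ x - (A i ⬝ᵥ x) ^ 2 / (A i ⬝ᵥ A i) := by
  have h : A i ⬝ᵥ A i ≠ 0 := fun h => hi (dotProduct_self_eq_zero.mp h)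
  rw [projMat_mulVec]
  simp only [sub_dotProduct, dotProduct_sub, smul_dotProduct, dotProduct_smul, smul_eq_mul,
    dotProduct_comm x (A i)]
  field_simp
  ring

/-- A product of the projections does not increase the norm of a vector, and preserves it only
if the vector is orthogonal to all the rows involved. -/
lemma prod_projMat_mulVec_dotProduct_self_le {m n : ℕ} (A : Matrix (Fin m) (Fin n) ℝ)
    (hA : ∀ i, A i ≠ 0) (l : List (Fin m)) (x : Fin n → ℝ) :
    ((l.reverse.map (projMat A)).prod *ᵥ x) ⬝ᵥ ((l.reverse.map (projMat A)).prod *ᵥ x) ≤ x ⬝ᵥ x ∧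
      (x ⬝ᵥ x ≤ ((l.reverse.map (projMat A)).prod *ᵥ x) ⬝ᵥ
          ((l.reverse.map (projMat A)).prod *ᵥ x) →
        ∀ i ∈ l, A i ⬝ᵥ x = 0) := by
  induction l generalizing x with
  | nil => simp
  | cons i l ih =>
    obtain ⟨hle, heq⟩ := ih (projMat A i *ᵥ x)
    have hpos : 0 < A i ⬝ᵥ A i :=
      lt_of_le_of_ne (Finset.sum_nonneg fun j _ => mul_self_nonneg (A i j))
        fun h => hA i (dotProduct_self_eq_zero.mp h.symm)
    have hproj := projMat_mulVec_dotProduct_self A (hA i) x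
    have hdiv : 0 ≤ (A i ⬝ᵥ x) ^ 2 / (A i ⬝ᵥ A i) := by positivity
    simp only [List.reverse_cons, List.map_append, List.map_cons, List.map_nil, List.prod_append,
      List.prod_singleton, ← mulVec_mulVec, List.mem_cons, forall_eq_or_imp]
    refine ⟨by linarith, fun h => ?_⟩
    have hzero : (A i ⬝ᵥ x) ^ 2 / (A i ⬝ᵥ A i) = 0 := by linarith
    have hi : A i ⬝ᵥ x = 0 := by simpa [hpos.ne'] using hzero
    have hx : projMat A i *ᵥ x = x := by simp [projMat_mulVec, hi]
    rw [hx] at heq h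
    exact ⟨hi, heq h⟩

/-- for every `x` with `Ax ≠ 0`, `‖Qx‖₂ < ‖x‖₂` strictly. -/
theorem stmt2 {m n : ℕ} (A : Matrix (Fin m) (Fin n) ℝ) (hA : ∀ i, A i ≠ 0) :
    ∀ x : Fin n → ℝ, A.mulVec x ≠ 0 → euclNorm ((Qmat A).mulVec x) < euclNorm x := by
  intro x hx
  rw [euclNorm_eq_sqrt_dotProduct, euclNorm_eq_sqrt_dotProduct]
  apply Real.sqrt_lt_sqrt (Finset.sum_nonneg fun i _ => mul_self_nonneg _)
  by_contra! h
  exact hx (funext fun i =>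
    (prod_projMat_mulVec_dotProduct_self_le A hA (List.finRange m) x).2 h i (List.mem_finRange i))

end
end

section
/- There exists a constant c < 1 such that ‖Qx‖₂ ≤ c‖x‖₂ for every x ∈ R(Aᵀ); equivalently, ‖Q̃‖₂ = sup{‖Qx‖₂ : x ∈ R(Aᵀ), ‖x‖₂ = 1} < 1, where Q̃ = Q P_{R(Aᵀ)} and P_{R(Aᵀ)} is the orthogonal projection of ℝⁿ onto R(Aᵀ). -/
open Matrix

noncomputable section

lemma euclNorm_nonneg {k : ℕ} (x : Fin k → ℝ) : 0 ≤ euclNorm x := Real.sqrt_nonneg _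

lemma euclNorm_eq_zero {k : ℕ} {x : Fin k → ℝ} : euclNorm x = 0 ↔ x = 0 := by
  rw [← dotProduct_self_eq_zero, ← euclNorm_sq, sq_eq_zero_iff]

lemma euclNorm_smul {k : ℕ} (r : ℝ) (x : Fin k → ℝ) : euclNorm (r • x) = |r| * euclNorm x := by
  rw [← abs_of_nonneg (euclNorm_nonneg (r • x)), ← abs_of_nonneg (euclNorm_nonneg x), ← abs_mul,
    ← sq_eq_sq_iff_abs_eq_abs, mul_pow, euclNorm_sq, euclNorm_sq]
  simp only [smul_dotProduct, dotProduct_smul, smul_eq_mul]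
  ring

lemma continuous_euclNorm {k : ℕ} : Continuous (euclNorm : (Fin k → ℝ) → ℝ) := by
  unfold euclNorm
  fun_prop

lemma isCompact_euclNorm_eq_one {k : ℕ} : IsCompact {x : Fin k → ℝ | euclNorm x = 1} := by
  refine Metric.isCompact_of_isClosed_isBounded
    (isClosed_eq continuous_euclNorm continuous_const) ?_
  refine (Metric.isBounded_closedBall (x := (0 : Fin k → ℝ)) (r := 1)).subset fun x hx => ?_
  rw [mem_closedBall_zero_iff, pi_norm_le_iff_of_nonneg zero_le_one]
  intro i
  have hx : euclNorm x = 1 := hx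
  have h : x i ^ 2 ≤ ∑ j, x j ^ 2 :=
    Finset.single_le_sum (f := fun j => x j ^ 2) (fun j _ => sq_nonneg _) (Finset.mem_univ i)
  calc |x i| = Real.sqrt (x i ^ 2) := (Real.sqrt_sq_eq_abs _).symm
    _ ≤ euclNorm x := Real.sqrt_le_sqrt h
    _ = 1 := hx

lemma dotProduct_projMat_mulVec_self {m n : ℕ} (A : Matrix (Fin m) (Fin n) ℝ) {i : Fin m}
    (hi : A i ≠ 0) (x : Fin n → ℝ) :
    projMat A i *ᵥ x ⬝ᵥ projMat A i *ᵥ x = x ⬝ᵥ x - (A i ⬝ᵥ A i)⁻¹ * (A i ⬝ᵥ x) ^ 2 := by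
  have h : A i ⬝ᵥ A i ≠ 0 := fun h => hi (dotProduct_self_eq_zero.1 h)
  rw [projMat_mulVec]
  simp only [sub_dotProduct, dotProduct_sub, smul_dotProduct, dotProduct_smul, smul_eq_mul,
    dotProduct_comm x (A i)]
  field_simp
  ring

/-- A product of the projections is a contraction, and any vector whose norm it does not decrease
is orthogonal to each of the rows involved. -/
lemma prod_projMat_contraction {m n : ℕ} (A : Matrix (Fin m) (Fin n) ℝ) (hA : ∀ i, A i ≠ 0)
    (l : List (Fin m)) (x : Fin n → ℝ) :
    euclNorm ((l.reverse.map (projMat A)).prod *ᵥ x) ≤ euclNorm x ∧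
      (euclNorm x ≤ euclNorm ((l.reverse.map (projMat A)).prod *ᵥ x) →
        ∀ i ∈ l, A i ⬝ᵥ x = 0) := by
  induction l generalizing x with
  | nil => simp
  | cons i l ih =>
    have hprod : (((i :: l).reverse.map (projMat A)).prod) *ᵥ x =
        (l.reverse.map (projMat A)).prod *ᵥ (projMat A i *ᵥ x) := by
      simp [mulVec_mulVec]
    have hpos : 0 < (A i ⬝ᵥ A i)⁻¹ := by
      rw [← euclNorm_sq]
      have := euclNorm_eq_zero.not.2 (hA i)
      positivity
    have hsq := dotProduct_projMat_mulVec_self A (hA i) x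
    rw [← euclNorm_sq, ← euclNorm_sq x] at hsq
    obtain ⟨hle, heq⟩ := ih (projMat A i *ᵥ x)
    have hproj : euclNorm (projMat A i *ᵥ x) ≤ euclNorm x := by
      refine (sq_le_sq₀ (euclNorm_nonneg _) (euclNorm_nonneg _)).1 ?_
      rw [hsq]
      exact sub_le_self _ (by positivity)
    rw [hprod]
    refine ⟨hle.trans hproj, fun h => ?_⟩
    have hx : A i ⬝ᵥ x = 0 := by
      rw [hproj.antisymm (h.trans hle), eq_comm, sub_eq_self, mul_eq_zero] at hsq
      simpa [hpos.ne'] using hsq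
    have hfix : projMat A i *ᵥ x = x := by simp [projMat_mulVec, hx]
    rw [hfix] at heq h
    simpa [hx] using heq h

lemma euclNorm_Qmat_mulVec_lt {m n : ℕ} (A : Matrix (Fin m) (Fin n) ℝ) (hA : ∀ i, A i ≠ 0)
    {x : Fin n → ℝ} (hx : A *ᵥ x ≠ 0) : euclNorm (Qmat A *ᵥ x) < euclNorm x := by
  by_contra! h
  exact hx <| funext fun i =>
    (prod_projMat_contraction A hA (List.finRange m) x).2 h i (List.mem_finRange i)

/-- there is a constant `c < 1` with `‖Qx‖₂ ≤ c‖x‖₂` for all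
`x ∈ R(Aᵀ) = N(A)^⊥`; equivalently `‖Q̃‖₂ < 1` where `Q̃ = Q P_{R(Aᵀ)}`. -/
theorem stmt3 {m n : ℕ} (A : Matrix (Fin m) (Fin n) ℝ) (hA : ∀ i, A i ≠ 0) :
    ∃ c : ℝ, c < 1 ∧ ∀ x : Fin n → ℝ,
      (∀ z : Fin n → ℝ, A.mulVec z = 0 → x ⬝ᵥ z = 0) →
        euclNorm ((Qmat A).mulVec x) ≤ c * euclNorm x := by
  set V : Set (Fin n → ℝ) := {x | ∀ z : Fin n → ℝ, A.mulVec z = 0 → x ⬝ᵥ z = 0} with hV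
  have hVclosed : IsClosed V := by
    simp only [hV, Set.ofPred_forall]
    exact isClosed_iInter fun z => isClosed_iInter fun _ =>
      isClosed_eq (by fun_prop) continuous_const
  have hcont : Continuous fun x : Fin n → ℝ => euclNorm (Qmat A *ᵥ x) :=
    continuous_euclNorm.comp (by fun_prop)
  obtain ⟨c, hc, hbound⟩ : ∃ c < 1, ∀ x ∈ V, euclNorm x = 1 → euclNorm (Qmat A *ᵥ x) ≤ c := by
    rcases ({x | euclNorm x = 1} ∩ V).eq_empty_or_nonempty with hempty | hne
    · exact ⟨0, one_pos, fun x hx h1 => (hempty.subset ⟨h1, hx⟩).elim⟩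
    · obtain ⟨x₀, ⟨h1, hx₀⟩, hmax⟩ :=
        (isCompact_euclNorm_eq_one.inter_right hVclosed).exists_isMaxOn hne hcont.continuousOn
      refine ⟨euclNorm (Qmat A *ᵥ x₀), ?_, fun x hx h => hmax ⟨h, hx⟩⟩
      rw [← (show euclNorm x₀ = 1 from h1)]
      refine euclNorm_Qmat_mulVec_lt A hA fun h0 => one_ne_zero (α := ℝ) ?_
      rw [← (show euclNorm x₀ = 1 from h1), euclNorm_eq_zero]
      exact dotProduct_self_eq_zero.1 (hx₀ x₀ h0)
  refine ⟨c, hc, fun x hx => ?_⟩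
  rcases eq_or_ne x 0 with rfl | hx0
  · simp [euclNorm]
  have hpos : 0 < euclNorm x := (euclNorm_nonneg x).lt_of_ne' (euclNorm_eq_zero.not.2 hx0)
  have h := hbound ((euclNorm x)⁻¹ • x) (fun z hz => by simp [hx z hz])
    (by rw [euclNorm_smul, abs_of_pos (inv_pos.2 hpos), inv_mul_cancel₀ hpos.ne'])
  rwa [mulVec_smul, euclNorm_smul, abs_of_pos (inv_pos.2 hpos), inv_mul_le_iff₀ hpos,
    mul_comm] at h

end
end

section
/- The identity I − A_SᵀMA = Q holds, i.e., the product of projections P_m P_{m−1} ⋯ P₁ equals I − A_SᵀMA. -/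
open Matrix

noncomputable section

theorem Qpart_mul_projMat {m n : ℕ} (A : Matrix (Fin m) (Fin n) ℝ) (j : Fin m) :
    Qpart A j * projMat A j =
      (((List.finRange m).drop (j : ℕ)).reverse.map (projMat A)).prod := by
  rw [List.drop_eq_getElem_cons (i := (j : ℕ)) (by simp)]
  simp [Qpart]

theorem sum_Qpart_mul_one_sub_projMat {m n : ℕ} (A : Matrix (Fin m) (Fin n) ℝ) :
    ∑ j, Qpart A j * (1 - projMat A j) = 1 - Qmat A := by
  let T : ℕ → Matrix (Fin n) (Fin n) ℝ := fun k =>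
    (((List.finRange m).drop k).reverse.map (projMat A)).prod
  calc ∑ j, Qpart A j * (1 - projMat A j)
      = ∑ j : Fin m, (T (j + 1) - T j) := by
        refine Finset.sum_congr rfl fun j _ => ?_
        rw [mul_sub, mul_one, Qpart_mul_projMat]
        rfl
    _ = T m - T 0 := by
        rw [Fin.sum_univ_eq_sum_range (fun k => T (k + 1) - T k) m, Finset.sum_range_sub]
    _ = 1 - Qmat A := by
        simp [T, Qmat, List.drop_eq_nil_of_le]

theorem AS_transpose_mul_Mdiag_mul {m n : ℕ} (A : Matrix (Fin m) (Fin n) ℝ) :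
    (AS A)ᵀ * Mdiag A * A = ∑ j, Qpart A j * (1 - projMat A j) := by
  have h (j : Fin m) : Qpart A j * (1 - projMat A j) =
      (euclNorm (A j) ^ 2)⁻¹ • Matrix.vecMulVec (AS A j) (A j) := by
    rw [projMat, sub_sub_cancel, Matrix.mul_smul, Matrix.mul_vecMulVec]
    rfl
  simp only [h]
  ext p q
  rw [Matrix.sum_apply, Matrix.mul_apply]
  refine Finset.sum_congr rfl fun j _ => ?_
  rw [Mdiag, Matrix.mul_diagonal, Matrix.transpose_apply, Matrix.smul_apply,
    Matrix.vecMulVec_apply, smul_eq_mul]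
  ring

/-- the identity `I − A_SᵀMA = Q` holds. -/
theorem stmt4 {m n : ℕ} (A : Matrix (Fin m) (Fin n) ℝ) (hA : ∀ i, A i ≠ 0) :
    (1 : Matrix (Fin n) (Fin n) ℝ) - (AS A)ᵀ * Mdiag A * A = Qmat A := by
  rw [AS_transpose_mul_Mdiag_mul, sum_Qpart_mul_one_sub_projMat, sub_sub_cancel]

end
end

section
/- Let b ∈ ℝ^m, let y₀ ∈ ℝⁿ be arbitrary, and define the Kaczmarz–Tanabe iteration y_{k+1} = Q y_k + A_SᵀM b for k = 0,1,2,…. Then for every k ≥ 0, y_k − P_{N(A)}y₀ ∈ N(A)^⊥; equivalently, every iterate y_k lies in the affine subspace D_r = P_{N(A)}y₀ + N(A)^⊥. -/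
open Matrix

noncomputable section

/-- Products of the row projections do not change the inner product with a null vector of `A`. -/
theorem prod_projMat_mulVec_dotProduct {m n : ℕ} (A : Matrix (Fin m) (Fin n) ℝ)
    {z : Fin n → ℝ} (hz : A.mulVec z = 0) (l : List (Fin m)) (x : Fin n → ℝ) :
    ((l.map (projMat A)).prod.mulVec x) ⬝ᵥ z = x ⬝ᵥ z := by
  induction l with
  | nil => simp
  | cons i l ih =>
    have hi : A i ⬝ᵥ z = 0 := congrFun hz i
    rw [List.map_cons, List.prod_cons, ← Matrix.mulVec_mulVec, projMat, Matrix.sub_mulVec,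
      Matrix.one_mulVec, sub_dotProduct, ih, Matrix.smul_mulVec, Matrix.vecMulVec_mulVec]
    simp [hi]

/-- The null space of `A` is contained in that of `A_S`. -/
theorem AS_mulVec_eq_zero {m n : ℕ} (A : Matrix (Fin m) (Fin n) ℝ)
    {z : Fin n → ℝ} (hz : A.mulVec z = 0) : (AS A).mulVec z = 0 := by
  funext j
  exact (prod_projMat_mulVec_dotProduct A hz _ (A j)).trans (congrFun hz j)

/-- for the Kaczmarz–Tanabe iteration `y_{k+1} = Q y_k + A_SᵀM b`,
every iterate satisfies `y_k − P_{N(A)}y₀ ∈ N(A)^⊥`, i.e. `y_k` lies in the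
affine subspace `D_r = P_{N(A)}y₀ + N(A)^⊥`. -/
theorem stmt8 {m n : ℕ} (A : Matrix (Fin m) (Fin n) ℝ) (hA : ∀ i, A i ≠ 0)
    (b : Fin m → ℝ) (y : ℕ → Fin n → ℝ)
    (hy : ∀ k, y (k + 1) = (Qmat A).mulVec (y k) + (AS A)ᵀ.mulVec ((Mdiag A).mulVec b))
    (Py0 : Fin n → ℝ) (hPy0a : A.mulVec Py0 = 0)
    (hPy0b : ∀ z : Fin n → ℝ, A.mulVec z = 0 → (y 0 - Py0) ⬝ᵥ z = 0) :
    ∀ k, ∀ z : Fin n → ℝ, A.mulVec z = 0 → (y k - Py0) ⬝ᵥ z = 0 := by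
  intro k z hz
  induction k with
  | zero => exact hPy0b z hz
  | succ k ih =>
    rw [sub_dotProduct] at ih
    rw [hy, sub_dotProduct, add_dotProduct, Qmat, prod_projMat_mulVec_dotProduct A hz,
      Matrix.mulVec_transpose, ← Matrix.dotProduct_mulVec, AS_mulVec_eq_zero A hz,
      dotProduct_zero, add_zero, ih]

end
end

section
/- The identity (A_SᵀMA)ᵀ(2I − A_SᵀMA) = (I − QᵀQ) + (Q − Qᵀ) holds, where (Q − Qᵀ)/2 is the anti-symmetric part of Q. -/
open Matrix

noncomputable section

/-- The product `P_{m−1} ⋯ P_k` of the last `m − k` projections. -/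
def tailProd {m n : ℕ} (A : Matrix (Fin m) (Fin n) ℝ) (k : ℕ) : Matrix (Fin n) (Fin n) ℝ :=
  (((List.finRange m).drop k).reverse.map (projMat A)).prod

theorem tailProd_eq_mul_projMat {m n : ℕ} (A : Matrix (Fin m) (Fin n) ℝ) (j : Fin m) :
    tailProd A j = tailProd A ((j : ℕ) + 1) * projMat A j := by
  have hj : (j : ℕ) < (List.finRange m).length := by simp
  simp [tailProd, List.drop_eq_getElem_cons hj]

theorem AS_transpose_mul_Mdiag_mul_eq_one_sub {m n : ℕ} (A : Matrix (Fin m) (Fin n) ℝ) :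
    (AS A)ᵀ * Mdiag A * A = 1 - Qmat A := by
  have hstep (j : Fin m) :
      Qpart A j * (1 - projMat A j) = tailProd A ((j : ℕ) + 1) - tailProd A j := by
    rw [tailProd_eq_mul_projMat, mul_sub, mul_one]
    rfl
  rw [AS_transpose_mul_Mdiag_mul, Finset.sum_congr rfl fun j _ => hstep j,
    Fin.sum_univ_eq_sum_range (fun k => tailProd A (k + 1) - tailProd A k) m,
    Finset.sum_range_sub]
  have hdrop : (List.finRange m).drop m = [] := List.drop_eq_nil_of_le (by simp)
  simp only [tailProd, hdrop, Qmat, List.drop_zero, List.reverse_nil, List.map_nil, List.prod_nil]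

/-- `(A_SᵀMA)ᵀ(2I − A_SᵀMA) = (I − QᵀQ) + (Q − Qᵀ)`. -/
theorem stmt10 {m n : ℕ} (A : Matrix (Fin m) (Fin n) ℝ) (hA : ∀ i, A i ≠ 0) :
    ((AS A)ᵀ * Mdiag A * A)ᵀ * ((2 : Matrix (Fin n) (Fin n) ℝ) - (AS A)ᵀ * Mdiag A * A) =
      ((1 : Matrix (Fin n) (Fin n) ℝ) - (Qmat A)ᵀ * Qmat A) + (Qmat A - (Qmat A)ᵀ) := by
  rw [AS_transpose_mul_Mdiag_mul_eq_one_sub, Matrix.transpose_sub, Matrix.transpose_one,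
    ← one_add_one_eq_two]
  noncomm_ring

end
end
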